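/- Let X be a nontrivial mm-space of finite diameter (i.e. μ_X is not a Dirac measure). Then for any 0 < κ < 1, liminf_{n→∞} ObsDiam(X_1^n; -κ)/√n ≥ 2 Φ^{-1}(κ) √(V_1(X)), where Φ(r) = ∫_r^∞ (2π)^{-1/2} e^{-t²/2} dt, Φ^{-1} is its inverse function on (0,1), and V_1(X) = sup_{x ∈ X} V(d_X(x,·)) with V(f) = ∫_X (f - ∫_X f dμ_X)² dμ_X the variance of f. -/

import Mathlib

open MeasureTheory Filter Topology Bornology

noncomputable section

/-- The partial diameter `diam(ν; α)` of a Borel measure `ν` on `ℝ`. -/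
def partialDiam (ν : Measure ℝ) (α : ℝ) : ℝ :=
  sInf {r : ℝ | ∃ A : Set ℝ, MeasurableSet A ∧ IsBounded A ∧
    ENNReal.ofReal α ≤ ν A ∧ r = Metric.diam A}

/-- The observable diameter `ObsDiam(X; -κ)` with respect to an explicit distance `d`. -/
def obsDiam {X : Type*} [MeasurableSpace X] (d : X → X → ℝ)
    (μ : Measure X) (κ : ℝ) : ℝ :=
  sSup {r : ℝ | ∃ f : X → ℝ, Measurable f ∧ (∀ x y, |f x - f y| ≤ d x y) ∧
    r = partialDiam (μ.map f) (1 - κ)}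

/-- The Gaussian tail function `Φ(r) = ∫_r^∞ (2π)^{-1/2} e^{-t²/2} dt`. -/
def gaussTail (r : ℝ) : ℝ :=
  ∫ t in Set.Ioi r, (Real.sqrt (2 * Real.pi))⁻¹ * Real.exp (-t ^ 2 / 2)

/-- The inverse function `Φ⁻¹` of the Gaussian tail function (on `(0,1)`). -/
def gaussTailInv : ℝ → ℝ := Function.invFun gaussTail

/-- The variance `V(f) = ∫ (f - ∫ f dμ)² dμ`. -/
def var {X : Type*} [MeasurableSpace X] (μ : Measure X) (f : X → ℝ) : ℝ :=
  ∫ x, (f x - ∫ y, f y ∂μ) ^ 2 ∂μ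


section Helpers

open ProbabilityTheory

lemma gaussTail_eq (r : ℝ) : gaussianReal 0 1 (Set.Ioi r) = ENNReal.ofReal (gaussTail r) := by
  rw [gaussianReal_apply_eq_integral _ one_ne_zero]
  unfold gaussTail gaussianPDFReal
  simp

lemma gaussTail_nonneg (r : ℝ) : 0 ≤ gaussTail r := by
  unfold gaussTail; positivity

lemma gaussTail_strict {r t : ℝ} (h : r < t) : gaussTail t < gaussTail r := by
  have h1 : gaussianReal 0 1 (Set.Ioi t) < gaussianReal 0 1 (Set.Ioi r) := by
    have hpos : 0 < gaussianReal 0 1 (Set.Ioc r t) := by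
      rw [pos_iff_ne_zero]
      intro h0
      have := gaussianReal_absolutelyContinuous' 0 (one_ne_zero) h0
      simp at this
      linarith
    have : Set.Ioi r = Set.Ioc r t ∪ Set.Ioi t := (Set.Ioc_union_Ioi_eq_Ioi h.le).symm
    rw [this, measure_union (by simp) measurableSet_Ioi, add_comm]
    exact ENNReal.lt_add_right (measure_ne_top _ _) hpos.ne'
  rw [gaussTail_eq, gaussTail_eq] at h1
  exact lt_of_not_ge fun h => absurd (ENNReal.ofReal_le_ofReal h) h1.not_ge

lemma gaussTail_eq_cdf (r : ℝ) : gaussTail r = 1 - cdf (gaussianReal 0 1) r := by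
  have h := gaussTail_eq r
  rw [cdf_eq_real, ← probReal_compl_eq_one_sub measurableSet_Iic, Set.compl_Iic, measureReal_def, h,
    ENNReal.toReal_ofReal (gaussTail_nonneg r)]

lemma gaussTail_continuous : Continuous gaussTail := by
  have hi : Integrable (fun t : ℝ => (Real.sqrt (2 * Real.pi))⁻¹ * Real.exp (-t ^ 2 / 2)) := by
    have := integrable_gaussianPDFReal 0 1
    unfold gaussianPDFReal at this
    simpa using this
  have : gaussTail = fun r => gaussTail 0 -
      ∫ t in (0:ℝ)..r, (Real.sqrt (2 * Real.pi))⁻¹ * Real.exp (-t ^ 2 / 2) := by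
    ext r
    have := intervalIntegral.integral_Ioi_sub_Ioi' (f := fun t : ℝ => (Real.sqrt (2 * Real.pi))⁻¹ * Real.exp (-t ^ 2 / 2)) (a := 0) (b := r) (μ := volume) hi.integrableOn hi.integrableOn
    unfold gaussTail
    linarith
  rw [this]
  exact continuous_const.sub (hi.continuous_primitive 0)

lemma gaussTail_inv {κ : ℝ} (h0 : 0 < κ) (h1 : κ < 1) : gaussTail (gaussTailInv κ) = κ := by
  apply Function.invFun_eq
  have ht : Tendsto gaussTail atTop (𝓝 0) := by
    have := (tendsto_cdf_atTop (gaussianReal 0 1)).const_sub 1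
    rw [sub_self] at this
    exact this.congr fun r => (gaussTail_eq_cdf r).symm
  have hb : Tendsto gaussTail atBot (𝓝 1) := by
    have := (tendsto_cdf_atBot (gaussianReal 0 1)).const_sub 1
    rw [sub_zero] at this
    exact this.congr fun r => (gaussTail_eq_cdf r).symm
  exact mem_range_of_exists_le_of_exists_ge gaussTail_continuous
    ((ht.eventually_le_const h0).exists) ((hb.eventually_const_le h1).exists)

lemma gauss_symm (r : ℝ) : gaussianReal 0 1 (Set.Iio (-r)) = gaussianReal 0 1 (Set.Ioi r) := by
  have h : (gaussianReal 0 1).map (fun x => -x) = gaussianReal 0 1 := by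
    simpa using gaussianReal_map_neg (μ := 0) (v := 1)
  conv_lhs => rw [← h]
  rw [Measure.map_apply measurable_neg measurableSet_Iio]
  simp

/-- CLT consequence. -/
lemma clt_tails {X : Type*} [MeasurableSpace X] (μ : Measure X) [IsProbabilityMeasure μ]
    (f : X → ℝ) (hf : Measurable f) (hL : MemLp f 2 μ) (hv : 0 < var μ f)
    {κ b : ℝ} (hκ0 : 0 < κ) (hb : κ < gaussTail (b / √(var μ f))) :
    ∀ᶠ n : ℕ in atTop,
      ENNReal.ofReal κ < (Measure.pi fun _ : Fin n => μ)
        {y | b * √n < ∑ i, f (y i) - n * ∫ x, f x ∂μ} ∧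
      ENNReal.ofReal κ < (Measure.pi fun _ : Fin n => μ)
        {y | ∑ i, f (y i) - n * ∫ x, f x ∂μ < - (b * √n)} := by
  set P := Measure.infinitePi (fun _ : ℕ => μ) with hP
  set v := var μ f with hvdef
  let Z : ℕ → (ℕ → X) → ℝ := fun i ω => f (ω i)
  have hlaw : ∀ i, MeasurePreserving (fun ω : ℕ → X => ω i) P μ :=
    fun i => measurePreserving_eval_infinitePi _ i
  have hZm : ∀ i, Measurable (Z i) := fun i => hf.comp (measurable_pi_apply i)
  have hmean : P[Z 0] = ∫ x, f x ∂μ := by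
    have := integral_map (μ := P) (φ := fun ω : ℕ → X => ω 0) (f := f) (hlaw 0).measurable.aemeasurable hf.aestronglyMeasurable
    rw [(hlaw 0).map_eq] at this
    exact this.symm
  have hvar : Var[Z 0; P] = v := by
    have := variance_map (μ := P) (X := f) (Y := fun ω : ℕ → X => ω 0) hf.aemeasurable (hlaw 0).measurable.aemeasurable
    rw [(hlaw 0).map_eq] at this
    rw [hvdef, var, ← variance_eq_integral hf.aemeasurable]
    exact this.symm
  have hY : HasLaw (fun x : ℝ => √v * x) (gaussianReal 0 Var[Z 0; P].toNNReal) (gaussianReal 0 1) := by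
    refine ⟨by fun_prop, ?_⟩
    rw [gaussianReal_map_const_mul, hvar]
    congr 1
    · simp
    · ext
      simp [Real.sq_sqrt hv.le, hv.le]
  have hclt := tendstoInDistribution_inv_sqrt_mul_sum_sub (X := Z) (P := P) hY
    (hL.comp_measurePreserving (hlaw 0))
    (iIndepFun_infinitePi (P := fun _ : ℕ => μ) (X := fun _ => f) (fun _ => hf))
    (fun i => by
      refine ⟨(hZm i).aemeasurable, (hZm 0).aemeasurable, ?_⟩
      have h : ∀ i, P.map (Z i) = μ.map f := fun i => by
        rw [← (hlaw i).map_eq, Measure.map_map hf (hlaw i).measurable]; rfl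
      rw [h, h])
  have hsv : 0 < √v := Real.sqrt_pos.2 hv
  have hproj : ∀ n : ℕ, MeasurePreserving (fun (ω : ℕ → X) (i : Fin n) => ω i) P
      (Measure.pi fun _ : Fin n => μ) := by
    intro n
    refine ⟨by fun_prop, ?_⟩
    have hind := (iIndepFun_infinitePi (P := fun _ : ℕ => μ) (X := fun _ (x : X) => x)
      (fun _ => measurable_id)).precomp (g := fun i : Fin n => (i : ℕ)) Fin.val_injective
    refine ((iIndepFun_iff_map_fun_eq_pi_map (ι := Fin n) (μ := P)
      (f := fun (i : Fin n) (ω : ℕ → X) => ω i)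
      (fun i => (hlaw i).measurable.aemeasurable)).1 hind).trans ?_
    congr 1
    ext1 i
    exact (hlaw i).map_eq
  have key : ∀ G : Set ℝ, IsOpen G →
      ENNReal.ofReal κ < gaussianReal 0 1 ((fun x => √v * x) ⁻¹' G) →
      ∀ᶠ n : ℕ in atTop, ENNReal.ofReal κ < (Measure.pi fun _ : Fin n => μ)
        {y | (√n)⁻¹ * (∑ i, f (y i) - n * ∫ x, f x ∂μ) ∈ G} := by
    intro G hG hlt
    have h1 := ProbabilityMeasure.le_liminf_measure_open_of_tendsto hclt.tendsto hG
    simp only [ProbabilityMeasure.coe_mk] at h1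
    rw [Measure.map_apply (by fun_prop) hG.measurableSet] at h1
    filter_upwards [eventually_lt_of_lt_liminf (hlt.trans_le h1)] with n hn
    refine hn.trans_eq ?_
    rw [Measure.map_apply (by fun_prop) hG.measurableSet, ← (hproj n).measure_preimage]
    · congr 1
      ext ω
      simp only [Set.mem_preimage, Set.mem_ofPred_eq, hmean, Z, Finset.sum_range]
    · refine MeasurableSet.nullMeasurableSet ?_
      refine (?_ : Measurable fun y : Fin n → X => _) hG.measurableSet
      fun_prop
  have hb' : ENNReal.ofReal κ < gaussianReal 0 1 (Set.Ioi (b / √v)) := by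
    rw [gaussTail_eq]
    exact (ENNReal.ofReal_lt_ofReal_iff (hκ0.trans hb)).2 hb
  have k1 := key (Set.Ioi b) isOpen_Ioi (by
    convert hb' using 2
    ext x
    simp only [Set.mem_preimage, Set.mem_Ioi]
    rw [div_lt_iff₀' hsv])
  have k2 := key (Set.Iio (-b)) isOpen_Iio (by
    rw [← gauss_symm] at hb'
    convert hb' using 2
    ext x
    simp only [Set.mem_preimage, Set.mem_Iio]
    rw [← neg_div, lt_div_iff₀' hsv])
  filter_upwards [k1, k2, eventually_gt_atTop 0] with n h1 h2 hn
  have hsn : 0 < √(n : ℝ) := Real.sqrt_pos.2 (by exact_mod_cast hn)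
  constructor
  · convert h1 using 3
    ext y
    simp only [Set.mem_Ioi]
    rw [inv_mul_eq_div, lt_div_iff₀ hsn]
  · convert h2 using 3
    ext y
    simp only [Set.mem_Iio]
    rw [inv_mul_eq_div, div_lt_iff₀ hsn, neg_mul]

lemma sq_int_le {Y : Type*} [MeasurableSpace Y] (ν : Measure Y) [IsProbabilityMeasure ν]
    (g : Y → ℝ) (hg : Measurable g) (D : ℝ) (h : ∀ x y, |g x - g y| ≤ D) :
    ∫ x, g x ^ 2 ∂ν ≤ (∫ x, g x ∂ν) ^ 2 + D ^ 2 := by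
  obtain ⟨x0⟩ : Nonempty Y := nonempty_of_isProbabilityMeasure ν
  have hD : 0 ≤ D := (abs_nonneg _).trans (h x0 x0)
  have hbd : ∀ x, |g x| ≤ |g x0| + D := fun x => by
    have := h x x0
    have := abs_sub_abs_le_abs_sub (g x) (g x0)
    linarith
  have hL : MemLp g 2 ν := MemLp.of_bound hg.aestronglyMeasurable (|g x0| + D) (ae_of_all _ hbd)
  have hi : Integrable g ν := hL.integrable (by norm_num)
  have hvar := variance_eq_sub hL
  have : Var[g; ν] ≤ D ^ 2 := by
    rw [variance_eq_integral hg.aemeasurable]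
    have : ∀ x, (g x - ∫ y, g y ∂ν) ^ 2 ≤ D ^ 2 := fun x => by
      rw [sq_le_sq, abs_of_nonneg hD]
      have : g x - ∫ y, g y ∂ν = ∫ y, (g x - g y) ∂ν := by
        rw [integral_sub (integrable_const _) hi]; simp
      rw [this]
      have := norm_integral_le_of_norm_le_const (μ := ν) (f := fun y => g x - g y) (C := D)
        (ae_of_all _ (h x))
      simpa using this
    refine (integral_mono_of_nonneg (ae_of_all _ fun x => sq_nonneg _) (integrable_const (D ^ 2))
      (ae_of_all _ this)).trans ?_
    simp
  simp only [Pi.pow_apply] at hvar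
  linarith

lemma lip_bdd {X : Type*} [MetricSpace X] {D : ℝ} (hD : ∀ x y : X, dist x y ≤ D) {n : ℕ}
    {f : (Fin n → X) → ℝ} (hl : ∀ x y, |f x - f y| ≤ ∑ i, dist (x i) (y i)) (x y) :
    |f x - f y| ≤ n * D := by
  refine (hl x y).trans ((Finset.sum_le_sum fun i _ => hD _ _).trans ?_)
  simp

lemma efron_stein {X : Type*} [MetricSpace X] [MeasurableSpace X]
    (μ : Measure X) [IsProbabilityMeasure μ] (D : ℝ) (hD : ∀ x y : X, dist x y ≤ D) (n : ℕ) :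
    ∀ f : (Fin n → X) → ℝ, Measurable f → (∀ x y, |f x - f y| ≤ ∑ i, dist (x i) (y i)) →
    ∫ x, f x ^ 2 ∂(Measure.pi fun _ : Fin n => μ) ≤
      (∫ x, f x ∂(Measure.pi fun _ : Fin n => μ)) ^ 2 + n * D ^ 2 := by
  induction n with
  | zero =>
    intro f hf hl
    simpa using sq_int_le (Measure.pi fun _ : Fin 0 => μ) f hf 0
      (fun x y => (hl x y).trans (by simp))
  | succ n ih =>
    intro f hf hl
    have hmp := (measurePreserving_piFinSuccAbove (fun _ : Fin (n + 1) => μ) 0).symm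
    set e := (MeasurableEquiv.piFinSuccAbove (fun _ : Fin (n + 1) => X) 0).symm with he
    set ν := Measure.pi fun _ : Fin n => μ with hν
    change MeasurePreserving e (μ.prod ν) _ at hmp
    have he1 : ∀ p i, e p i = (Fin.cons p.1 p.2 : Fin (n + 1) → X) i := by
      intro p i
      change Fin.insertNth (α := fun _ => X) 0 p.1 p.2 i = _
      rw [Fin.insertNth_zero']
    rw [← hmp.integral_comp', ← hmp.integral_comp']
    obtain ⟨x0⟩ : Nonempty X := nonempty_of_isProbabilityMeasure μ
    obtain ⟨C, hC⟩ : ∃ C, ∀ x, |f x| ≤ C := ⟨|f fun _ => x0| + (n + 1 : ℕ) * D, fun x => by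
      have := lip_bdd hD hl x (fun _ => x0)
      have := abs_sub_abs_le_abs_sub (f x) (f fun _ => x0)
      linarith⟩
    have hfe : Measurable fun p => f (e p) := hf.comp e.measurable
    have hi1 : Integrable (fun p => f (e p)) (μ.prod ν) :=
      Integrable.of_bound hfe.aestronglyMeasurable C (ae_of_all _ fun p => hC _)
    have hi2 : Integrable (fun p => f (e p) ^ 2) (μ.prod ν) :=
      Integrable.of_bound (hfe.pow_const 2).aestronglyMeasurable (C ^ 2) (ae_of_all _ fun p => by
        rw [Real.norm_eq_abs, abs_pow]
        exact pow_le_pow_left₀ (abs_nonneg _) (hC _) 2)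
    rw [integral_prod_symm _ hi1, integral_prod_symm _ hi2]
    set g : (Fin n → X) → ℝ := fun y => ∫ x, f (e (x, y)) ∂μ with hg
    have hgm : Measurable g := by
      have h := (hfe.comp measurable_swap).stronglyMeasurable.integral_prod_right' (ν := μ)
      exact h.measurable
    have hsl : ∀ y, Measurable fun x => f (e (x, y)) := fun y => hfe.comp (by fun_prop)
    have hsi : ∀ y, Integrable (fun x => f (e (x, y))) μ := fun y =>
      Integrable.of_bound (hsl y).aestronglyMeasurable C (ae_of_all _ fun p => hC _)
    have hgC : ∀ y, |g y| ≤ C := fun y => by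
      have := norm_integral_le_of_norm_le_const (μ := μ) (f := fun x => f (e (x, y))) (C := C)
        (ae_of_all _ fun x => hC _)
      simpa using this
    have hgl : ∀ y z, |g y - g z| ≤ ∑ i, dist (y i) (z i) := fun y z => by
      have h1 : g y - g z = ∫ x, (f (e (x, y)) - f (e (x, z))) ∂μ := by
        rw [integral_sub (hsi y) (hsi z)]
      rw [h1]
      have := norm_integral_le_of_norm_le_const (μ := μ)
        (f := fun x => f (e (x, y)) - f (e (x, z))) (C := ∑ i, dist (y i) (z i))
        (ae_of_all _ fun x => (hl _ _).trans (by simp [he1, Fin.sum_univ_succ]))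
      simpa using this
    have hstep : ∀ y, ∫ x, f (e (x, y)) ^ 2 ∂μ ≤ g y ^ 2 + D ^ 2 := fun y =>
      sq_int_le μ _ (hsl y) D fun x x' => (hl _ _).trans (by
        simpa [he1, Fin.sum_univ_succ] using hD x x')
    have hgi : Integrable (fun y => g y ^ 2) ν :=
      Integrable.of_bound (hgm.pow_const 2).aestronglyMeasurable (C ^ 2) (ae_of_all _ fun p => by
        rw [Real.norm_eq_abs, abs_pow]
        exact pow_le_pow_left₀ (abs_nonneg _) (hgC _) 2)
    calc ∫ y, ∫ x, f (e (x, y)) ^ 2 ∂μ ∂ν ≤ ∫ y, (g y ^ 2 + D ^ 2) ∂ν :=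
          integral_mono_of_nonneg (ae_of_all _ fun y => integral_nonneg fun x => sq_nonneg _)
            (hgi.add (integrable_const _)) (ae_of_all _ hstep)
      _ = ∫ y, g y ^ 2 ∂ν + D ^ 2 := by
          rw [integral_add hgi (integrable_const _)]; simp
      _ ≤ (∫ y, g y ∂ν) ^ 2 + n * D ^ 2 + D ^ 2 := by
          have := ih g hgm hgl
          linarith
      _ = _ := by push_cast; ring

lemma partialDiam_nonneg (ν : Measure ℝ) (α : ℝ) : 0 ≤ partialDiam ν α := by
  apply Real.sInf_nonneg
  rintro r ⟨A, -, -, -, rfl⟩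
  exact Metric.diam_nonneg

lemma obsDiam_nonneg {X : Type*} [MeasurableSpace X] (d : X → X → ℝ)
    (μ : Measure X) (κ : ℝ) : 0 ≤ obsDiam d μ κ := by
  apply Real.sSup_nonneg
  rintro r ⟨f, -, -, rfl⟩
  exact partialDiam_nonneg _ _

lemma partialDiam_le {X : Type*} [MetricSpace X] [MeasurableSpace X]
    (μ : Measure X) [IsProbabilityMeasure μ] (D : ℝ) (hD0 : 0 < D) (hD : ∀ x y : X, dist x y ≤ D)
    {n : ℕ} (hn : 0 < n) {κ : ℝ} (hκ0 : 0 < κ) 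
    (f : (Fin n → X) → ℝ) (hf : Measurable f) (hl : ∀ x y, |f x - f y| ≤ ∑ i, dist (x i) (y i)) :
    partialDiam ((Measure.pi fun _ : Fin n => μ).map f) (1 - κ) ≤ 2 * (D / √κ) * √n := by
  set ν := Measure.pi fun _ : Fin n => μ with hν
  obtain ⟨x0⟩ : Nonempty X := nonempty_of_isProbabilityMeasure μ
  have hL : MemLp f 2 ν := MemLp.of_bound hf.aestronglyMeasurable
    (|f fun _ => x0| + n * D) (ae_of_all _ fun x => by
      have := lip_bdd hD hl x (fun _ => x0)
      have := abs_sub_abs_le_abs_sub (f x) (f fun _ => x0)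
      rw [Real.norm_eq_abs]
      linarith)
  have hvar : Var[f; ν] ≤ n * D ^ 2 := by
    have h1 := variance_eq_sub hL
    have h2 := efron_stein μ D hD n f hf hl
    simp only [Pi.pow_apply] at h1
    linarith
  set c := (D / √κ) * √n with hc
  have hn' : (0:ℝ) < n := by exact_mod_cast hn
  have hc0 : 0 < c := by positivity
  have hch := meas_ge_le_variance_div_sq hL hc0
  have hcκ : Var[f; ν] / c ^ 2 ≤ κ := by
    rw [div_le_iff₀ (by positivity), hc, mul_pow, div_pow, Real.sq_sqrt hκ0.le, Real.sq_sqrt hn'.le]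
    refine hvar.trans_eq ?_
    field_simp
  set m := ∫ x, f x ∂ν with hm
  have hmem : ENNReal.ofReal (1 - κ) ≤ ν.map f (Metric.ball m c) := by
    rw [Measure.map_apply hf Metric.isOpen_ball.measurableSet]
    have hms : MeasurableSet (f ⁻¹' Metric.ball m c) := hf Metric.isOpen_ball.measurableSet
    have hcompl : ν (f ⁻¹' Metric.ball m c)ᶜ ≤ ENNReal.ofReal κ := by
      refine le_trans (le_of_eq ?_) (hch.trans (ENNReal.ofReal_le_ofReal hcκ))
      congr 1
      ext x
      simp [Real.dist_eq, hm]
    have hadd := prob_compl_eq_one_sub (μ := ν) hms.compl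
    rw [compl_compl] at hadd
    rw [hadd, ENNReal.ofReal_sub _ hκ0.le, ENNReal.ofReal_one]
    exact tsub_le_tsub_left hcompl _
  have hle : partialDiam (ν.map f) (1 - κ) ≤ Metric.diam (Metric.ball m c) := by
    apply csInf_le
    · refine ⟨0, ?_⟩
      rintro r ⟨A, -, -, -, rfl⟩
      exact Metric.diam_nonneg
    · exact ⟨_, Metric.isOpen_ball.measurableSet, Metric.isBounded_ball, hmem, rfl⟩
  refine hle.trans ((Metric.diam_ball hc0.le).trans_eq ?_)
  rw [hc]; ring

lemma le_partialDiam (ν : Measure ℝ) [IsProbabilityMeasure ν] {κ : ℝ} (hκ0 : 0 < κ) (hκ1 : κ < 1)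
    (m b : ℝ) (h1 : ENNReal.ofReal κ < ν (Set.Ioi (m + b)))
    (h2 : ENNReal.ofReal κ < ν (Set.Iio (m - b))) :
    2 * b ≤ partialDiam ν (1 - κ) := by
  have aux : ∀ A B : Set ℝ, MeasurableSet A → MeasurableSet B → ENNReal.ofReal (1 - κ) ≤ ν A →
      ENNReal.ofReal κ < ν B → ¬ Disjoint A B := by
    intro A B hA hB hA1 hB1 hd
    have h : ν A + ν B ≤ 1 := by
      rw [← measure_union hd hB]; exact prob_le_one
    have : (1 : ENNReal) < ν A + ν B := by
      have h3 : ENNReal.ofReal (1 - κ) + ENNReal.ofReal κ = 1 := by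
        rw [← ENNReal.ofReal_add (by linarith) hκ0.le]; simp
      rw [← h3]
      exact ENNReal.add_lt_add_of_le_of_lt ENNReal.ofReal_ne_top hA1 hB1
    exact absurd h this.not_ge
  apply le_csInf
  · -- nonempty
    have ht : Tendsto (fun n : ℕ => ν (Metric.ball 0 n)) atTop (𝓝 1) := by
      have := tendsto_measure_iUnion_atTop (μ := ν) (s := fun n : ℕ => Metric.ball (0:ℝ) n)
        (fun i j hij => Metric.ball_subset_ball (by exact_mod_cast hij))
      rwa [Metric.iUnion_ball_nat, measure_univ] at this
    have hlt : ENNReal.ofReal (1 - κ) < 1 := by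
      rw [ENNReal.ofReal_lt_one]; linarith
    obtain ⟨n, hn⟩ := (ht.eventually_const_le hlt).exists
    exact ⟨_, _, Metric.isOpen_ball.measurableSet, Metric.isBounded_ball, hn, rfl⟩
  · rintro r ⟨A, hA, hAb, hAν, rfl⟩
    obtain ⟨x, hxA, hx⟩ := Set.not_disjoint_iff.1 (aux A _ hA measurableSet_Ioi hAν h1)
    obtain ⟨y, hyA, hy⟩ := Set.not_disjoint_iff.1 (aux A _ hA measurableSet_Iio hAν h2)
    have := Metric.dist_le_diam_of_mem hAb hxA hyA
    have h3 := le_abs_self (x - y)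
    rw [Real.dist_eq] at this
    simp only [Set.mem_Ioi, Set.mem_Iio] at hx hy
    linarith

end Helpers

/-- **Theorem 1.3.** For a nontrivial mm-space `X` of finite diameter and `0 < κ < 1`,
`liminf_n ObsDiam(X_1^n;-κ)/√n ≥ 2 Φ⁻¹(κ) √(V_1(X))`. -/
theorem liminf_obsDiam_l1_product_ge
    {X : Type*} [MetricSpace X] [CompleteSpace X] [TopologicalSpace.SeparableSpace X]
    [MeasurableSpace X] [BorelSpace X]
    (μ : Measure X) [IsProbabilityMeasure μ]
    (hnt : ∀ x : X, μ ≠ Measure.dirac x)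
    (hbdd : IsBounded (Set.univ : Set X))
    (κ : ℝ) (hκ0 : 0 < κ) (hκ1 : κ < 1) :
    2 * gaussTailInv κ * Real.sqrt (⨆ x : X, var μ fun y => dist x y) ≤
      liminf (fun n : ℕ =>
        obsDiam (fun x y : Fin n → X => ∑ i, dist (x i) (y i))
          (Measure.pi fun _ : Fin n => μ) κ / Real.sqrt n) atTop := by
  obtain ⟨D, hD⟩ := Metric.isBounded_iff.1 hbdd
  have hD' : ∀ x y : X, dist x y ≤ |D| + 1 := fun x y =>
    (hD (Set.mem_univ x) (Set.mem_univ y)).trans (by linarith [le_abs_self D])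
  have hD0 : 0 < |D| + 1 := by positivity
  obtain ⟨x0⟩ : Nonempty X := nonempty_of_isProbabilityMeasure μ
  set u : ℕ → ℝ := fun n : ℕ =>
        obsDiam (fun x y : Fin n → X => ∑ i, dist (x i) (y i))
          (Measure.pi fun _ : Fin n => μ) κ / Real.sqrt n with hu
  set C := 2 * ((|D| + 1) / √κ) with hC
  have hub : ∀ᶠ n in atTop, u n ≤ C := by
    filter_upwards [eventually_gt_atTop 0] with n hn
    have hsn : 0 < √(n : ℝ) := Real.sqrt_pos.2 (by exact_mod_cast hn)
    rw [hu, div_le_iff₀ hsn]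
    apply Real.sSup_le
    · rintro r ⟨f, hf, hl, rfl⟩
      exact partialDiam_le μ _ hD0 hD' hn hκ0 f hf hl
    · positivity
  have hcob : IsCoboundedUnder (· ≥ ·) atTop u :=
    IsBoundedUnder.isCoboundedUnder_ge ⟨C, hub⟩
  have hL0 : 0 ≤ liminf u atTop :=
    le_liminf_of_le hcob (Eventually.of_forall fun n =>
      div_nonneg (obsDiam_nonneg _ _ _) (Real.sqrt_nonneg _))
  rcases le_or_gt (gaussTailInv κ) 0 with ht | ht
  · refine le_trans ?_ hL0
    have := Real.sqrt_nonneg (⨆ x : X, var μ fun y => dist x y)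
    nlinarith
  have hx : ∀ x : X, 2 * gaussTailInv κ * √(var μ fun y => dist x y) ≤ liminf u atTop := by
    intro x
    rcases le_or_gt (var μ fun y => dist x y) 0 with hv | hv
    · rw [Real.sqrt_eq_zero_of_nonpos hv, mul_zero]
      exact hL0
    have hsv := Real.sqrt_pos.2 hv
    refine le_of_forall_lt_imp_le_of_dense fun a ha => ?_
    have hab : (a / 2) / √(var μ fun y => dist x y) < gaussTailInv κ := by
      rw [div_lt_iff₀ hsv]; linarith
    have hκt := gaussTail_strict hab
    rw [gaussTail_inv hκ0 hκ1] at hκt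
    have hfm : Measurable fun y : X => dist x y := (continuous_const.dist continuous_id).measurable
    have hclt := clt_tails μ (fun y => dist x y) hfm
      (MemLp.of_bound hfm.aestronglyMeasurable (|D| + 1) (ae_of_all _ fun y => by
        rw [Real.norm_eq_abs, abs_of_nonneg dist_nonneg]; exact hD' x y)) hv hκ0 hκt
    refine le_liminf_of_le hcob ?_
    filter_upwards [hclt, eventually_gt_atTop 0] with n hn hn0
    have hsn : 0 < √(n : ℝ) := Real.sqrt_pos.2 (by exact_mod_cast hn0)
    rw [hu, le_div_iff₀ hsn]
    have hSm : Measurable fun y : Fin n → X => ∑ i, dist x (y i) :=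
      Finset.measurable_sum _ fun i _ => hfm.comp (measurable_pi_apply i)
    have hSl : ∀ y z : Fin n → X, |∑ i, dist x (y i) - ∑ i, dist x (z i)| ≤
        ∑ i, dist (y i) (z i) := fun y z => by
      rw [← Finset.sum_sub_distrib]
      refine (Finset.abs_sum_le_sum_abs _ _).trans (Finset.sum_le_sum fun i _ => ?_)
      rw [dist_comm x, dist_comm x]
      exact abs_dist_sub_le _ _ _
    have : IsProbabilityMeasure ((Measure.pi fun _ : Fin n => μ).map
        fun y : Fin n → X => ∑ i, dist x (y i)) :=
      Measure.isProbabilityMeasure_map hSm.aemeasurable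
    have h1 := le_partialDiam ((Measure.pi fun _ : Fin n => μ).map
        fun y : Fin n → X => ∑ i, dist x (y i)) hκ0 hκ1 (n * ∫ y, dist x y ∂μ) (a / 2 * √n)
      (by
        rw [Measure.map_apply hSm measurableSet_Ioi]
        convert hn.1 using 2
        ext y
        simp only [Set.mem_preimage, Set.mem_Ioi, Set.mem_ofPred_eq]
        constructor <;> intro h <;> linarith)
      (by
        rw [Measure.map_apply hSm measurableSet_Iio]
        convert hn.2 using 2
        ext y
        simp only [Set.mem_preimage, Set.mem_Iio, Set.mem_ofPred_eq]
        constructor <;> intro h <;> linarith)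
    have h2 : partialDiam ((Measure.pi fun _ : Fin n => μ).map
        fun y : Fin n → X => ∑ i, dist x (y i)) (1 - κ) ≤
        obsDiam (fun x y : Fin n → X => ∑ i, dist (x i) (y i))
          (Measure.pi fun _ : Fin n => μ) κ := by
      apply le_csSup
      · refine ⟨C * √n, ?_⟩
        rintro r ⟨f, hf, hl, rfl⟩
        exact partialDiam_le μ _ hD0 hD' hn0 hκ0 f hf hl
      · exact ⟨_, hSm, hSl, rfl⟩
    linarith
  have hne : Nonempty X := ⟨x0⟩
  have h2t : 0 < 2 * gaussTailInv κ := by positivity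
  rw [← le_div_iff₀' h2t]
  apply Real.sqrt_le_iff.2
  refine ⟨by positivity, ciSup_le fun x => ?_⟩
  refine (Real.sqrt_le_left (by positivity)).1 ?_
  rw [le_div_iff₀' h2t]
  exact hx x
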